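/- Assume the matrix norms of S_N^{-1}A(x_i, z_j) and S_N^{-1}B₁(x_i, z_j) are bounded above by a constant M at all grid points, and let h_x ∈ [h₀, β_x). Then there exist h̄_z > 0 and a constant C > 0 such that for all h_z ∈ (0, h̄_z), every grid vector function W^h satisfying L^h(W^h)(x_i, z_j) = 0 for all i ≤ N_x − 1, j ≤ N_z − 1 obeys the Lipschitz stability estimate ‖W^h‖_{L²,h} ≤ C ‖G^h‖_{H¹,h} for every grid vector function G^h that agrees with W^h on ∂Ω^h. In particular, if W^h vanishes on ∂Ω^h and L^h(W^h) = 0, then W^h is identically zero, so the discrete boundary value problem L^h(W^h) = 0 with prescribed boundary values has at most one solution. -/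

import Mathlib

/-- A grid vector function: to each grid point (i, j) it assigns a vector in ℝ^N. -/
abbrev GridFun (Nx Nz N : ℕ) := Fin Nx → Fin Nz → Fin N → ℝ

/-- (i, j) is a boundary grid point of the grid. -/
def IsBdry {Nx Nz : ℕ} (i : Fin Nx) (j : Fin Nz) : Prop :=
  (i : ℕ) = 0 ∨ (i : ℕ) = Nx - 1 ∨ (j : ℕ) = 0 ∨ (j : ℕ) = Nz - 1

/-- W has boundary values F on ∂Ω^h. -/
def BdryEq {Nx Nz N : ℕ} (W F : GridFun Nx Nz N) : Prop :=
  ∀ i j, IsBdry i j → W i j = F i j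

/-- Squared Euclidean norm on ℝ^N. -/
def euclSq {N : ℕ} (v : Fin N → ℝ) : ℝ := ∑ k, v k ^ 2

/-- Euclidean inner product on ℝ^N. -/
def euclInner {N : ℕ} (v w : Fin N → ℝ) : ℝ := ∑ k, v k * w k

/-- The discrete operator
L^h(W)(x_i,z_j) = ∂_z^{h_z} W + S_N⁻¹ B₁ ∂_x^{h_x} W + S_N⁻¹ A W, for i ≤ N_x−1, j ≤ N_z−1,
with forward finite differences. `Sinv` stands for S_N⁻¹. -/
noncomputable def Lop {Nx Nz N : ℕ} (hx hz : ℝ) (Sinv : Matrix (Fin N) (Fin N) ℝ)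
    (A B : Fin Nx → Fin Nz → Matrix (Fin N) (Fin N) ℝ)
    (W : GridFun Nx Nz N) (i : Fin (Nx - 1)) (j : Fin (Nz - 1)) : Fin N → ℝ :=
  (fun k => (W ⟨i.1, by have := i.isLt; omega⟩ ⟨j.1 + 1, by have := j.isLt; omega⟩ k
      - W ⟨i.1, by have := i.isLt; omega⟩ ⟨j.1, by have := j.isLt; omega⟩ k) / hz)
  + (Sinv * B ⟨i.1, by have := i.isLt; omega⟩ ⟨j.1, by have := j.isLt; omega⟩).mulVec
      (fun k => (W ⟨i.1 + 1, by have := i.isLt; omega⟩ ⟨j.1, by have := j.isLt; omega⟩ k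
        - W ⟨i.1, by have := i.isLt; omega⟩ ⟨j.1, by have := j.isLt; omega⟩ k) / hx)
  + (Sinv * A ⟨i.1, by have := i.isLt; omega⟩ ⟨j.1, by have := j.isLt; omega⟩).mulVec
      (W ⟨i.1, by have := i.isLt; omega⟩ ⟨j.1, by have := j.isLt; omega⟩)

/-- Squared discrete L² norm: ‖W‖²_{L²,h} = h_x h_z Σ_{i,j} |W(x_i,z_j)|². -/
def normL2sq {Nx Nz N : ℕ} (hx hz : ℝ) (W : GridFun Nx Nz N) : ℝ :=
  hx * hz * ∑ i, ∑ j, euclSq (W i j)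

/-- Squared discrete H¹ norm:
‖W‖²_{H¹,h} = ‖W‖²_{L²,h} + h_x h_z Σ_{i ≤ Nx−1, j ≤ Nz−1} (|∂_x W|² + |∂_z W|²). -/
noncomputable def normH1sq {Nx Nz N : ℕ} (hx hz : ℝ) (W : GridFun Nx Nz N) : ℝ :=
  normL2sq hx hz W + hx * hz * ∑ i : Fin (Nx - 1), ∑ j : Fin (Nz - 1),
    (euclSq (fun k => (W ⟨i.1 + 1, by have := i.isLt; omega⟩ ⟨j.1, by have := j.isLt; omega⟩ k
        - W ⟨i.1, by have := i.isLt; omega⟩ ⟨j.1, by have := j.isLt; omega⟩ k) / hx)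
      + euclSq (fun k => (W ⟨i.1, by have := i.isLt; omega⟩ ⟨j.1 + 1, by have := j.isLt; omega⟩ k
        - W ⟨i.1, by have := i.isLt; omega⟩ ⟨j.1, by have := j.isLt; omega⟩ k) / hz))

/-- The discrete Tikhonov-like functional
J^h_ε(W) = h_x h_z Σ_{i ≤ Nx−1, j ≤ Nz−1} |L^h(W)(x_i,z_j)|² + ε ‖W‖²_{H¹,h}. -/
noncomputable def Jfun {Nx Nz N : ℕ} (hx hz ε : ℝ) (Sinv : Matrix (Fin N) (Fin N) ℝ)
    (A B : Fin Nx → Fin Nz → Matrix (Fin N) (Fin N) ℝ) (W : GridFun Nx Nz N) : ℝ :=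
  hx * hz * (∑ i : Fin (Nx - 1), ∑ j : Fin (Nz - 1), euclSq (Lop hx hz Sinv A B W i j))
    + ε * normH1sq hx hz W

theorem euclSq_nonneg' {N : ℕ} (v : Fin N → ℝ) : 0 ≤ euclSq v :=
  Finset.sum_nonneg fun _ _ => sq_nonneg _

theorem Lop_sub' {Nx Nz N : ℕ} (hx hz : ℝ) (T : Matrix (Fin N) (Fin N) ℝ)
    (A B : Fin Nx → Fin Nz → Matrix (Fin N) (Fin N) ℝ)
    (W V : GridFun Nx Nz N) (i : Fin (Nx - 1)) (j : Fin (Nz - 1)) :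
    Lop hx hz T A B (W - V) i j = Lop hx hz T A B W i j - Lop hx hz T A B V i j := by
  have key : ∀ (P Q : Matrix (Fin N) (Fin N) ℝ) (a b c a' b' c' : Fin N → ℝ),
      ((fun k => ((a - a') k - (b - b') k) / hz) + P.mulVec (fun k => ((c - c') k - (b - b') k) / hx)
        + Q.mulVec (b - b') : Fin N → ℝ)
      = ((fun k => (a k - b k) / hz) + P.mulVec (fun k => (c k - b k) / hx) + Q.mulVec b)
        - ((fun k => (a' k - b' k) / hz) + P.mulVec (fun k => (c' k - b' k) / hx)
          + Q.mulVec b') := by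
    intro P Q a b c a' b' c'
    have h1 : (fun k => ((c - c') k - (b - b') k) / hx)
        = (fun k => (c k - b k) / hx) - (fun k => (c' k - b' k) / hx) := by
      funext k; simp only [Pi.sub_apply]; ring
    rw [h1, Matrix.mulVec_sub, Matrix.mulVec_sub]
    funext k
    simp only [Pi.sub_apply, Pi.add_apply]
    ring
  exact key _ _ _ _ _ _ _ _

theorem step' {N : ℕ} (hx hz M : ℝ) (hx0 : 0 < hx) (hz0 : 0 < hz) (hz1 : hz < 1)
    (P Q : Matrix (Fin N) (Fin N) ℝ)
    (hP : ∀ v : Fin N → ℝ, euclSq (P.mulVec v) ≤ M ^ 2 * euclSq v)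
    (hQ : ∀ v : Fin N → ℝ, euclSq (Q.mulVec v) ≤ M ^ 2 * euclSq v)
    (a b c : Fin N → ℝ)
    (h : (fun k => (a k - b k) / hz) + P.mulVec (fun k => (c k - b k) / hx) + Q.mulVec b = 0)
    (t : ℝ) (hb : euclSq b ≤ t) (hc : euclSq c ≤ t) :
    euclSq a ≤ (1 + 3 * (1 + M ^ 2 * (4 / hx ^ 2) + M ^ 2)) * t := by
  have ht : 0 ≤ t := (euclSq_nonneg' b).trans hb
  set d : Fin N → ℝ := fun k => (c k - b k) / hx with hd
  have e1 : euclSq d ≤ (4 / hx ^ 2) * t := by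
    have : euclSq d ≤ (2 / hx ^ 2) * (euclSq c + euclSq b) := by
      unfold euclSq
      rw [← Finset.sum_add_distrib, Finset.mul_sum]
      refine Finset.sum_le_sum fun k _ => ?_
      rw [hd]
      simp only [div_pow]
      rw [div_mul_eq_mul_div]
      gcongr
      nlinarith [sq_nonneg (c k + b k)]
    refine this.trans ?_
    have : (4 / hx ^ 2) * t = (2 / hx ^ 2) * (t + t) := by ring
    rw [this]
    gcongr
  have e2 : euclSq a ≤ 3 * (euclSq b + euclSq (P.mulVec d) + euclSq (Q.mulVec b)) := by
    unfold euclSq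
    rw [← Finset.sum_add_distrib, ← Finset.sum_add_distrib, Finset.mul_sum]
    refine Finset.sum_le_sum fun k _ => ?_
    have hk := congrFun h k
    simp only [Pi.add_apply, Pi.zero_apply] at hk
    set p := P.mulVec d k
    set q := Q.mulVec b k
    have ha : a k = b k - hz * p - hz * q := by
      field_simp at hk
      linarith
    have h2 : hz ^ 2 ≤ 1 := by nlinarith
    have h3 : (a k) ^ 2 ≤ 3 * (b k ^ 2 + hz ^ 2 * p ^ 2 + hz ^ 2 * q ^ 2) := by
      rw [ha]
      nlinarith [sq_nonneg (b k + hz * p), sq_nonneg (b k + hz * q), sq_nonneg (hz * p - hz * q)]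
    nlinarith [mul_le_mul_of_nonneg_right h2 (sq_nonneg p),
      mul_le_mul_of_nonneg_right h2 (sq_nonneg q)]
  have e3 := hP d
  have e4 := hQ b
  have e5 := mul_le_mul_of_nonneg_left e1 (sq_nonneg M)
  have e6 := mul_le_mul_of_nonneg_left hb (sq_nonneg M)
  nlinarith

theorem main' (N Nx Nz : ℕ) (hx : ℝ) (hx0 : 0 < hx)
    (T : Matrix (Fin N) (Fin N) ℝ)
    (A B : Fin Nx → Fin Nz → Matrix (Fin N) (Fin N) ℝ) (M : ℝ)
    (hMA : ∀ i j (v : Fin N → ℝ), euclSq ((T * A i j).mulVec v) ≤ M ^ 2 * euclSq v)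
    (hMB : ∀ i j (v : Fin N → ℝ), euclSq ((T * B i j).mulVec v) ≤ M ^ 2 * euclSq v)
    (hz : ℝ) (hz0 : 0 < hz) (hz1 : hz < 1) (W : GridFun Nx Nz N)
    (hW : ∀ (i : Fin (Nx - 1)) (j : Fin (Nz - 1)), Lop hx hz T A B W i j = 0)
    (g : ℝ) (hg : ∀ i j, IsBdry i j → euclSq (W i j) ≤ g) (hg0 : 0 ≤ g) :
    ∀ (n : ℕ) (hn : n < Nz) (i : Fin Nx),
      euclSq (W i ⟨n, hn⟩) ≤ (1 + 3 * (1 + M ^ 2 * (4 / hx ^ 2) + M ^ 2)) ^ n * g := by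
  have hc : 1 ≤ 1 + 3 * (1 + M ^ 2 * (4 / hx ^ 2) + M ^ 2) := by
    have : 0 ≤ 3 * (1 + M ^ 2 * (4 / hx ^ 2) + M ^ 2) := by positivity
    linarith
  intro n
  induction n with
  | zero =>
    intro hn i
    have := hg i ⟨0, hn⟩ (Or.inr (Or.inr (Or.inl rfl)))
    simpa using this
  | succ n ih =>
    intro hn i
    by_cases hi : (i : ℕ) = Nx - 1
    · refine (hg i ⟨n + 1, hn⟩ (Or.inr (Or.inl hi))).trans ?_
      exact le_mul_of_one_le_left hg0 (one_le_pow₀ hc)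
    · have hi' : (i : ℕ) < Nx - 1 := by have := i.isLt; omega
      have hn' : n < Nz - 1 := by omega
      have h := hW ⟨i, hi'⟩ ⟨n, hn'⟩
      rw [pow_succ', mul_assoc]
      exact step' hx hz M hx0 hz0 hz1 _ _ (hMB i ⟨n, by omega⟩) (hMA i ⟨n, by omega⟩) _ _ _ h _
        (ih (by omega) i) (ih (by omega) _)

/-- Lipschitz stability and uniqueness for the discrete problem: assuming
the matrix (operator) norms of S⁻¹A and S⁻¹B₁ are bounded by M at all grid points and
h_x ∈ [h₀, β_x), there exist h̄_z > 0 and C > 0 such that for all h_z ∈ (0, h̄_z):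
every grid vector function W^h with L^h(W^h) = 0 satisfies
‖W^h‖_{L²,h} ≤ C ‖G^h‖_{H¹,h} for every grid vector function G^h agreeing with W^h on
∂Ω^h; in particular, if W^h vanishes on ∂Ω^h and L^h(W^h) = 0 then W^h ≡ 0, so the
discrete boundary value problem has at most one solution. -/
theorem stmt_13 (N Nx Nz : ℕ) (hN : 1 ≤ N) (hNx : 2 ≤ Nx) (hNz : 2 ≤ Nz)
    (R a b h₀ βx βz : ℝ) (hR : 1 < R) (ha : 0 < a) (hab : a < b)
    (hh₀ : 0 < h₀) (hβx : 0 < βx) (hβz : 0 < βz)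
    (hx : ℝ) (hhx : hx ∈ Set.Ico h₀ βx)
    (S : Matrix (Fin N) (Fin N) ℝ) (hS : IsUnit S.det)
    (A B : Fin Nx → Fin Nz → Matrix (Fin N) (Fin N) ℝ)
    (M : ℝ)
    (hMA : ∀ i j (v : Fin N → ℝ), euclSq ((S⁻¹ * A i j).mulVec v) ≤ M ^ 2 * euclSq v)
    (hMB : ∀ i j (v : Fin N → ℝ), euclSq ((S⁻¹ * B i j).mulVec v) ≤ M ^ 2 * euclSq v) :
    ∃ hbarz > 0, ∃ C > 0, ∀ hz ∈ Set.Ioo 0 hbarz,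
      (∀ W : GridFun Nx Nz N,
        (∀ (i : Fin (Nx - 1)) (j : Fin (Nz - 1)), Lop hx hz S⁻¹ A B W i j = 0) →
        ∀ G : GridFun Nx Nz N, BdryEq G W →
          Real.sqrt (normL2sq hx hz W) ≤ C * Real.sqrt (normH1sq hx hz G)) ∧
      (∀ W : GridFun Nx Nz N,
        (∀ (i : Fin (Nx - 1)) (j : Fin (Nz - 1)), Lop hx hz S⁻¹ A B W i j = 0) →
        BdryEq W 0 → W = 0) ∧
      (∀ W₁ W₂ : GridFun Nx Nz N,
        (∀ (i : Fin (Nx - 1)) (j : Fin (Nz - 1)), Lop hx hz S⁻¹ A B W₁ i j = 0) →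
        (∀ (i : Fin (Nx - 1)) (j : Fin (Nz - 1)), Lop hx hz S⁻¹ A B W₂ i j = 0) →
        BdryEq W₁ W₂ → W₁ = W₂) := by
  have hx0 : 0 < hx := lt_of_lt_of_le hh₀ hhx.1
  set c : ℝ := 1 + 3 * (1 + M ^ 2 * (4 / hx ^ 2) + M ^ 2) with hcdef
  have hc : 1 ≤ c := by
    have : 0 ≤ 3 * (1 + M ^ 2 * (4 / hx ^ 2) + M ^ 2) := by positivity
    linarith
  have uniq : ∀ hz ∈ Set.Ioo (0 : ℝ) 1, ∀ W : GridFun Nx Nz N,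
        (∀ (i : Fin (Nx - 1)) (j : Fin (Nz - 1)), Lop hx hz S⁻¹ A B W i j = 0) →
        BdryEq W 0 → W = 0 := by
    intro hz hhz W hW hb
    have h := main' N Nx Nz hx hx0 S⁻¹ A B M hMA hMB hz hhz.1 hhz.2 W hW 0
      (fun i j hij => by rw [hb i j hij]; simp [euclSq]) le_rfl
    funext i j k
    have h1 := h j.1 j.2 i
    rw [mul_zero] at h1
    have h2 : (W i j k) ^ 2 ≤ euclSq (W i j) :=
      Finset.single_le_sum (f := fun k => (W i j k) ^ 2) (fun _ _ => sq_nonneg _)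
        (Finset.mem_univ k)
    have h3 : (W i j k) ^ 2 = 0 := le_antisymm (h2.trans h1) (sq_nonneg _)
    simpa using h3
  refine ⟨1, one_pos, Real.sqrt (Nx * Nz * c ^ Nz), ?_, ?_⟩
  · have : (0 : ℝ) < Nx := by exact_mod_cast (by omega : 0 < Nx)
    have : (0 : ℝ) < Nz := by exact_mod_cast (by omega : 0 < Nz)
    positivity
  intro hz hhz
  have hz0 := hhz.1
  refine ⟨?_, uniq hz hhz, ?_⟩
  · intro W hW G hG
    set g : ℝ := ∑ i, ∑ j, euclSq (G i j) with hgdef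
    have hg0 : 0 ≤ g :=
      Finset.sum_nonneg fun _ _ => Finset.sum_nonneg fun _ _ => euclSq_nonneg' _
    have hg : ∀ i j, IsBdry i j → euclSq (W i j) ≤ g := by
      intro i j hij
      rw [← hG i j hij]
      refine (Finset.single_le_sum (f := fun j => euclSq (G i j))
        (fun _ _ => euclSq_nonneg' _) (Finset.mem_univ j)).trans ?_
      exact Finset.single_le_sum (f := fun i => ∑ j, euclSq (G i j))
        (fun _ _ => Finset.sum_nonneg fun _ _ => euclSq_nonneg' _) (Finset.mem_univ i)
    have h := main' N Nx Nz hx hx0 S⁻¹ A B M hMA hMB hz hhz.1 hhz.2 W hW g hg hg0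
    have hs : ∑ i, ∑ j, euclSq (W i j) ≤ Nx * Nz * c ^ Nz * g := by
      have : ∑ i : Fin Nx, ∑ j : Fin Nz, euclSq (W i j)
          ≤ ∑ _i : Fin Nx, ∑ _j : Fin Nz, c ^ Nz * g := by
        refine Finset.sum_le_sum fun i _ => Finset.sum_le_sum fun j _ => ?_
        refine (h j.1 j.2 i).trans ?_
        exact mul_le_mul_of_nonneg_right (pow_le_pow_right₀ hc j.2.le) hg0
      refine this.trans (le_of_eq ?_)
      simp
      ring
    rw [← Real.sqrt_mul (by positivity)]
    apply Real.sqrt_le_sqrt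
    have h1 : normL2sq hx hz G ≤ normH1sq hx hz G := by
      unfold normH1sq
      refine le_add_of_nonneg_right (mul_nonneg (by positivity) ?_)
      exact Finset.sum_nonneg fun _ _ => Finset.sum_nonneg fun _ _ =>
        add_nonneg (euclSq_nonneg' _) (euclSq_nonneg' _)
    refine le_trans ?_ (mul_le_mul_of_nonneg_left h1 (by positivity))
    unfold normL2sq
    calc hx * hz * ∑ i, ∑ j, euclSq (W i j) ≤ hx * hz * (Nx * Nz * c ^ Nz * g) :=
          mul_le_mul_of_nonneg_left hs (by positivity)
      _ = _ := by ring
  · intro W₁ W₂ h₁ h₂ hb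
    refine sub_eq_zero.mp (uniq hz hhz (W₁ - W₂) ?_ ?_)
    · intro i j
      rw [Lop_sub', h₁, h₂, sub_zero]
    · intro i j hij
      show W₁ i j - W₂ i j = 0
      rw [hb i j hij, sub_self]
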